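/- Let K be a field of characteristic 0, R = K[x_1,…,x_{10}], and let X be the (3×4)-matrix with rows (0, x_1, x_2, x_3), (0, x_4, x_5, x_6), (x_7, x_8, x_9, x_{10}). Let I = I_3(X) be the ideal of R generated by the 3×3 minors of X. Then the local cohomology module H^3_I(R) is nonzero. -/

import Mathlib

/-- The ideal generated by the `t × t` minors of a matrix. -/
def minorsIdeal {R : Type*} [CommRing R] {m n : ℕ} (t : ℕ)
    (X : Matrix (Fin m) (Fin n) R) : Ideal R :=
  Ideal.span { d | ∃ (r : Fin t → Fin m) (c : Fin t → Fin n),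
    Function.Injective r ∧ Function.Injective c ∧ d = (X.submatrix r c).det }

/-- The `(3 × 4)`-matrix with rows `(0, x₁, x₂, x₃)`, `(0, x₄, x₅, x₆)`,
`(x₇, x₈, x₉, x₁₀)` over `K[x₁, …, x₁₀]`, where the variables `x₁, …, x₁₀` are
indexed by `Fin 10` starting from `0`. -/
noncomputable def exampleMatrix12 (K : Type*) [Field K] :
    Matrix (Fin 3) (Fin 4) (MvPolynomial (Fin 10) K) :=
  !![0, MvPolynomial.X 0, MvPolynomial.X 1, MvPolynomial.X 2;
     0, MvPolynomial.X 3, MvPolynomial.X 4, MvPolynomial.X 5;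
     MvPolynomial.X 6, MvPolynomial.X 7, MvPolynomial.X 8, MvPolynomial.X 9]

namespace Stmt12Aux
section
universe u v w

open CategoryTheory Limits Opposite

theorem desc_of_homology_zero {D : Type u} [Category.{v} D] [Abelian D]
    (L : ChainComplex D ℕ) (W : D) [Injective W] (α : L.X 3 ⟶ W) (hα : L.d 4 3 ≫ α = 0)
    (h : L.homologyι 3 ≫ L.descOpcycles α 4 (by simp) hα = 0) :
    ∃ β : L.X 2 ⟶ W, L.d 3 2 ≫ β = α := by
  have h1 : L.iCycles 3 ≫ α = 0 := by
    have := congrArg (fun z => L.homologyπ 3 ≫ z) h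
    simpa using this
  have hex : (ShortComplex.mk (L.iCycles 3) (L.d 3 2) (by simp)).Exact :=
    ShortComplex.exact_of_f_is_kernel _ (L.cyclesIsKernel 3 2 (by simp))
  exact ⟨hex.descToInjective α h1, hex.comp_descToInjective _ _⟩

theorem desc_of_homologyMap_zero {D : Type u} [Category.{v} D] [Abelian D]
    (L L' : ChainComplex D ℕ) (G : L' ⟶ L) (W : D) [Injective W] (α : L.X 3 ⟶ W)
    (hα : L.d 4 3 ≫ α = 0)
    (h : HomologicalComplex.homologyMap G 3 ≫ L.homologyι 3 ≫
      L.descOpcycles α 4 (by simp) hα = 0) :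
    ∃ β : L'.X 2 ⟶ W, L'.d 3 2 ≫ β = G.f 3 ≫ α := by
  have hα'' : L'.d 4 3 ≫ (G.f 3 ≫ α) = 0 := by
    rw [← G.comm_assoc, hα, comp_zero]
  refine desc_of_homology_zero L' W (G.f 3 ≫ α) hα'' ?_
  rw [HomologicalComplex.homologyι_naturality_assoc] at h
  rw [← h]
  congr 1
  rw [← cancel_epi (L'.pOpcycles 3)]
  simp

theorem leftDerived_class {C : Type u} [Category.{v} C] [Abelian C] [EnoughProjectives C]
    {D : Type w} [Category.{v} D] [Abelian D] (F : C ⥤ D) [F.Additive] {X : C}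
    (P : ProjectiveResolution X) (W : D) [Injective W]
    (α : F.obj (P.complex.X 3) ⟶ W) (hα : F.map (P.complex.d 4 3) ≫ α = 0) :
    ∃ e : (F.leftDerived 3).obj X ⟶ W, ∀ (X' : C) (f : X' ⟶ X) (P' : ProjectiveResolution X')
      (g : P'.complex ⟶ P.complex) (_ : g.f 0 ≫ P.π.f 0 = P'.π.f 0 ≫ f),
      (F.leftDerived 3).map f ≫ e = 0 →
      ∃ β : F.obj (P'.complex.X 2) ⟶ W, F.map (P'.complex.d 3 2) ≫ β = F.map (g.f 3) ≫ α := by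
  let L := (F.mapHomologicalComplex (ComplexShape.down ℕ)).obj P.complex
  have hα' : L.d 4 3 ≫ α = 0 := hα
  let k : (HomologicalComplex.homologyFunctor D _ 3).obj L ⟶ W :=
    L.homologyι 3 ≫ L.descOpcycles α 4 (by simp) hα'
  refine ⟨(P.isoLeftDerivedObj F 3).hom ≫ k, ?_⟩
  intro X' f P' g hg h0
  refine desc_of_homologyMap_zero L ((F.mapHomologicalComplex (ComplexShape.down ℕ)).obj P'.complex)
    ((F.mapHomologicalComplex (ComplexShape.down ℕ)).map g) W α hα' ?_
  rw [← Category.assoc, P'.isoLeftDerivedObj_hom_naturality f P g hg F 3, Category.assoc] at h0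
  have h1 := congrArg (fun z => (P'.isoLeftDerivedObj F 3).inv ≫ z) h0
  rw [Iso.inv_hom_id_assoc, comp_zero] at h1
  exact h1

theorem ext_class {R : Type u} [CommRing R] {X : ModuleCat.{u} R} (M : ModuleCat.{u} R)
    (P : ProjectiveResolution X) (φ : P.complex.X 3 ⟶ M) (hφ : P.complex.d 4 3 ≫ φ = 0) :
    ∃ e : ((Ext R (ModuleCat.{u} R) 3).obj (op X)).obj M, ∀ (X' : ModuleCat.{u} R) (f : X' ⟶ X)
      (P' : ProjectiveResolution X')
      (g : P'.complex ⟶ P.complex) (_ : g.f 0 ≫ P.π.f 0 = P'.π.f 0 ≫ f),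
      (((Ext R (ModuleCat.{u} R) 3).map f.op).app M).hom e = 0 →
      ∃ β : P'.complex.X 2 ⟶ M, P'.complex.d 3 2 ≫ β = g.f 3 ≫ φ := by
  let F : ModuleCat.{u} R ⥤ (ModuleCat.{u} R)ᵒᵖ := ((linearYoneda R (ModuleCat.{u} R)).obj M).rightOp
  have : Projective (ModuleCat.of R R) := (IsProjective.iff_projective (R := R) (P := R)).1 inferInstance
  let a : ModuleCat.of R R ⟶ ModuleCat.of R (P.complex.X 3 ⟶ M) :=
    ModuleCat.ofHom (LinearMap.toSpanSingleton R _ φ)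
  obtain ⟨e, he⟩ := leftDerived_class F P (op (ModuleCat.of R R)) a.op (by
    apply Quiver.Hom.unop_inj
    ext
    have h1 : P.complex.d 4 3 ≫ ((1 : R) • φ) = 0 := by rw [one_smul, hφ]
    exact h1)
  refine ⟨e.unop.hom (1 : R), ?_⟩
  intro X' f P' g hg h0
  obtain ⟨β, hβ⟩ := he X' f P' g hg (by
    apply Quiver.Hom.unop_inj
    ext
    exact h0)
  refine ⟨β.unop.hom (1:R), ?_⟩
  have h1 : P'.complex.d 3 2 ≫ (β.unop.hom (1 : R) : P'.complex.X 2 ⟶ M) =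
      g.f 3 ≫ ((1 : R) • φ) :=
    congrArg (fun z => z.unop.hom (1 : R)) hβ
  rw [h1, one_smul]

theorem localCoh_class {R : Type u} [CommRing R] (J : Ideal R) (t : ℕ) (M : ModuleCat.{u} R)
    (P : ProjectiveResolution (ModuleCat.of R (R ⧸ J ^ t)))
    (φ : P.complex.X 3 ⟶ M) (hφ : P.complex.d 4 3 ≫ φ = 0)
    (hsub : Subsingleton ((localCohomology J 3).obj M)) :
    ∃ (t' : ℕ) (h : J ^ t' ≤ J ^ t) (P' : ProjectiveResolution (ModuleCat.of R (R ⧸ J ^ t')))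
      (g : P'.complex ⟶ P.complex) (_ : g.f 0 ≫ P.π.f 0 = P'.π.f 0 ≫
        ModuleCat.ofHom (Submodule.mapQ _ _ LinearMap.id h))
      (β : P'.complex.X 2 ⟶ M), P'.complex.d 3 2 ≫ β = g.f 3 ≫ φ := by
  obtain ⟨e, he⟩ := ext_class M P φ hφ
  let Dg := localCohomology.diagram (localCohomology.idealPowersDiagram J) 3
  have : HasColimit Dg := localCohomology.hasColimitDiagram.{u,0} _ _
  let c := ((evaluation _ _).obj M).mapCocone (colimit.cocone Dg)
  have hc : IsColimit c := isColimitOfPreserves _ (colimit.isColimit Dg)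
  have hs : Subsingleton (ToType c.pt) := hsub
  have : PreservesFilteredColimitsOfSize.{0, 0} (forget (ModuleCat.{u} R)) :=
    preservesSmallestFilteredColimits_of_preservesFilteredColimits _
  have : IsFiltered ℕᵒᵖᵒᵖ := inferInstance
  have : PreservesColimitsOfShape ℕᵒᵖᵒᵖ (forget (ModuleCat.{u} R)) := inferInstance
  obtain ⟨k, f, g, hfg⟩ := Concrete.isColimit_exists_of_rep_eq (Dg ⋙ (evaluation _ _).obj M) hc
     (i := op (op t)) (j := op (op t)) e (0 : ((Ext R (ModuleCat.{u} R) 3).obj (op (ModuleCat.of R (R ⧸ J ^ t)))).obj M) (hs.elim _ _)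
  let P' := projectiveResolution (ModuleCat.of R (R ⧸ J ^ k.unop.unop))
  have h : J ^ k.unop.unop ≤ J ^ t := Ideal.pow_le_pow_right (leOfHom f.unop.unop)
  let F : ModuleCat.of R (R ⧸ J ^ k.unop.unop) ⟶ ModuleCat.of R (R ⧸ J ^ t) := ModuleCat.ofHom (Submodule.mapQ _ _ LinearMap.id h)
  have hl := ProjectiveResolution.lift_commutes_zero F P' P
  obtain ⟨β, hβ⟩ := he _ F P' (ProjectiveResolution.lift F P' P) hl (by
    refine hfg.trans ?_
    exact map_zero (((Ext R (ModuleCat.{u} R) 3).map _).app M).hom)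
  exact ⟨_, h, P', _, hl, β, hβ⟩
open Matrix

theorem lift_lin {R : Type u} [CommRing R] {P M N L : Type*} [AddCommGroup P] [AddCommGroup M]
    [AddCommGroup N] [AddCommGroup L] [Module R P] [Module R M] [Module R N] [Module R L]
    [Module.Projective R P] (f : M →ₗ[R] N) (g : N →ₗ[R] L)
    (hfg : ∀ y, g y = 0 → ∃ x, f x = y) (h : P →ₗ[R] N) (hgh : ∀ p, g (h p) = 0) :
    ∃ k : P →ₗ[R] M, ∀ p, f (k p) = h p := by
  obtain ⟨k, hk⟩ := Module.projective_lifting_property f.rangeRestrict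
    (h.codRestrict (LinearMap.range f) (fun p => hfg _ (hgh p))) f.surjective_rangeRestrict
  exact ⟨k, fun p => congrArg Subtype.val (LinearMap.congr_fun hk p)⟩

/-- Koszul exactness of a triple. -/
structure KExact {R : Type u} [CommRing R] (q : Fin 3 → R) : Prop where
  e1 : ∀ v : Fin 3 → R, q ⬝ᵥ v = 0 → ∃ w, crossProduct q w = v
  e2 : ∀ v : Fin 3 → R, crossProduct q v = 0 → ∃ r : R, r • q = v
  e3 : ∀ r : R, r • q = 0 → r = 0

/-- dot product with a vector as a linear map -/
def kdot {R : Type u} [CommRing R] (q : Fin 3 → R) : (Fin 3 → R) →ₗ[R] R where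
  toFun v := q ⬝ᵥ v
  map_add' := by intros; simp
  map_smul' := by intros; simp

/-- the last Koszul differential -/
abbrev ksmul {R : Type u} [CommRing R] (q : Fin 3 → R) : R →ₗ[R] (Fin 3 → R) :=
  LinearMap.toSpanSingleton R _ q

theorem kdot_cross {R : Type u} [CommRing R] (q v : Fin 3 → R) : kdot q (crossProduct q v) = 0 := by
  simp [kdot]

theorem cross_ksmul {R : Type u} [CommRing R] (q : Fin 3 → R) (r : R) :
    crossProduct q (ksmul q r) = 0 := by
  simp [ksmul]

theorem apply_mem_span {R : Type u} [CommRing R] (F : Fin 3 → R) (h : (Fin 3 → R) →ₗ[R] R) :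
    h F ∈ Ideal.span (Set.range F) := by
  rw [LinearMap.pi_apply_eq_sum_univ h F]
  exact Ideal.sum_mem _ fun i _ => Ideal.mul_mem_right _ _ (Ideal.subset_span ⟨i, rfl⟩)

theorem mem_span_kdot {R : Type u} [CommRing R] (q : Fin 3 → R) (r : R)
    (h : r ∈ Ideal.span (Set.range q)) : ∃ v, kdot q v = r := by
  obtain ⟨c, hc⟩ := (Ideal.mem_span_range_iff_exists_fun).1 h
  exact ⟨c, by rw [← hc]; simp [kdot, dotProduct, mul_comm]⟩

theorem compare {R : Type u} [CommRing R] (q F : Fin 3 → R) (hq : KExact q)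
    (M : Matrix (Fin 3) (Fin 3) R) (hM : M *ᵥ q = F)
    (Φ0 Φ3 : R →ₗ[R] R) (Φ1 Φ2 : (Fin 3 → R) →ₗ[R] (Fin 3 → R))
    (h0 : Φ0 1 - 1 ∈ Ideal.span (Set.range q))
    (h1 : ∀ v, kdot q (Φ1 v) = Φ0 (kdot F v))
    (h2 : ∀ v, crossProduct q (Φ2 v) = Φ1 (crossProduct F v))
    (h3 : ∀ r, ksmul q (Φ3 r) = Φ2 (ksmul F r)) :
    Φ3 1 - M.det ∈ Ideal.span (Set.range F) := by
  obtain ⟨v0, hv0⟩ := mem_span_kdot q _ h0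
  let H0 : R →ₗ[R] (Fin 3 → R) := LinearMap.toSpanSingleton R _ v0
  have hH0 : ∀ r, kdot q (H0 r) = Φ0 r - r := by
    intro r
    have : Φ0 r = r * Φ0 1 := by rw [← smul_eq_mul, ← map_smul]; simp
    simp only [H0, LinearMap.toSpanSingleton_apply, map_smul, hv0, this, smul_eq_mul]; ring
  obtain ⟨H1, hH1⟩ := lift_lin (crossProduct q) (kdot q) (fun v hv => hq.e1 v hv)
    (Φ1 - Mᵀ.mulVecLin - H0 ∘ₗ kdot F) (by
      intro v
      simp only [LinearMap.sub_apply, map_sub, LinearMap.comp_apply, hH0, h1]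
      subst hM
      have e : q ⬝ᵥ (Mᵀ *ᵥ v) = (M *ᵥ q) ⬝ᵥ v := by
        rw [Matrix.mulVec_transpose, dotProduct_comm q, ← Matrix.dotProduct_mulVec, dotProduct_comm]
      simp only [kdot, LinearMap.coe_mk, AddHom.coe_mk, Matrix.mulVecLin_apply, e]
      ring)
  obtain ⟨H2, hH2⟩ := lift_lin (ksmul q) (crossProduct q) (fun v hv => hq.e2 v hv)
    (Φ2 - M.adjugate.mulVecLin - H1 ∘ₗ crossProduct F) (by
      intro v
      have key : crossProduct q (M.adjugate *ᵥ v) = Mᵀ *ᵥ (crossProduct F v) := by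
        subst hM
        rw [Matrix.adjugate_fin_three]
        ext i
        fin_cases i <;>
          simp [Matrix.mulVec, dotProduct, cross_apply, Fin.sum_univ_three] <;> ring
      simp only [LinearMap.sub_apply, map_sub, LinearMap.comp_apply, hH1, h2, kdot_cross,
        Matrix.mulVecLin_apply, key, map_zero]
      simp)
  have hH3 : Φ3 1 - M.det - H2 F = 0 := by
    apply hq.e3
    have a1 := h3 1
    have a2 := hH2 F
    have a3 : M.adjugate *ᵥ F = M.det • q := by
      rw [← hM, Matrix.mulVec_mulVec, Matrix.adjugate_mul, Matrix.smul_mulVec, Matrix.one_mulVec]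
    simp only [LinearMap.toSpanSingleton_apply, one_smul, LinearMap.sub_apply,
      LinearMap.comp_apply, Matrix.mulVecLin_apply, a3, cross_self, map_zero, sub_zero] at a1 a2
    rw [sub_smul, sub_smul, a1, a2]; abel
  have := apply_mem_span F H2
  rwa [sub_eq_zero.1 hH3]

theorem res_exact {R : Type u} [CommRing R] {X : ModuleCat.{u} R} (P : ProjectiveResolution X)
    (n : ℕ) (y : P.complex.X (n + 1)) (hy : (P.complex.d (n + 1) n).hom y = 0) :
    ∃ x, (P.complex.d (n + 2) (n + 1)).hom x = y :=
  (ShortComplex.moduleCat_exact_iff _).1 (P.exact_succ n) y hy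

theorem res_exact_zero {R : Type u} [CommRing R] {X : ModuleCat.{u} R} (P : ProjectiveResolution X)
    (y : P.complex.X 0) (hy : (P.π.f 0).hom y = 0) :
    ∃ x, (P.complex.d 1 0).hom x = y :=
  (ShortComplex.moduleCat_exact_iff _).1 P.exact₀ y hy

theorem res_surj {R : Type u} [CommRing R] {X : ModuleCat.{u} R} (P : ProjectiveResolution X)
    (x : X) : ∃ y, (P.π.f 0).hom y = x :=
  (ModuleCat.epi_iff_surjective (P.π.f 0)).1 inferInstance x

theorem res_dd {R : Type u} [CommRing R] {X : ModuleCat.{u} R} (P : ProjectiveResolution X)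
    (i j k : ℕ) (y : P.complex.X i) :
    (P.complex.d j k).hom ((P.complex.d i j).hom y) = 0 := by
  have := P.complex.d_comp_d i j k
  exact congrArg (fun z => z.hom y) this

theorem res_proj {R : Type u} [CommRing R] {X : ModuleCat.{u} R} (P : ProjectiveResolution X)
    (i : ℕ) : Module.Projective R (P.complex.X i) :=
  (IsProjective.iff_projective (P.complex.X i)).2 (P.projective i)

theorem main_alg {R : Type u} [CommRing R] (J : Ideal R) (q f : Fin 3 → R) (hq : KExact q) (t : ℕ)
    (hJ : J ^ t ≤ Ideal.span (Set.range q)) (hf : ∀ i, f i ∈ J)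
    (hsub : Subsingleton ((localCohomology J 3).obj (ModuleCat.of R R))) :
    ∃ t' : ℕ, ∀ n, t' ≤ n → ∀ M : Matrix (Fin 3) (Fin 3) R, M *ᵥ q = (fun i => f i ^ n) →
      M.det ∈ Ideal.span (Set.range (fun i => f i ^ n)) := by
  let P := projectiveResolution (ModuleCat.of R (R ⧸ J ^ t))
  have hP := res_proj P
  let Q := Ideal.span (Set.range q)
  let pr : R ⧸ J ^ t →ₗ[R] R ⧸ Q := Submodule.mapQ (J ^ t) Q LinearMap.id hJ
  let mk : R →ₗ[R] R ⧸ Q := Submodule.mkQ Q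
  let π : P.complex.X 0 →ₗ[R] R ⧸ J ^ t := (P.π.f 0).hom
  obtain ⟨φ0, hφ0⟩ : ∃ φ0 : P.complex.X 0 →ₗ[R] R, ∀ p, mk (φ0 p) = pr (π p) := by
    obtain ⟨k, hk⟩ := Module.projective_lifting_property mk (pr ∘ₗ π) (Submodule.mkQ_surjective _)
    exact ⟨k, fun p => LinearMap.congr_fun hk p⟩
  have hd0 : ∀ p, π ((P.complex.d 1 0).hom p) = 0 := fun p =>
    congrArg (fun z => z.hom p) P.complex_d_comp_π_f_zero
  have hmk : ∀ r, mk r = 0 → ∃ v, kdot q v = r := fun r hr =>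
    mem_span_kdot q r ((Submodule.Quotient.mk_eq_zero _).1 hr)
  obtain ⟨φ1, hφ1⟩ := lift_lin (kdot q) mk hmk (φ0 ∘ₗ (P.complex.d 1 0).hom) (by
    intro p; rw [LinearMap.comp_apply, hφ0, hd0, map_zero])
  obtain ⟨φ2, hφ2⟩ := lift_lin (crossProduct q) (kdot q) (fun v hv => hq.e1 v hv)
    (φ1 ∘ₗ (P.complex.d 2 1).hom) (by
      intro p
      rw [LinearMap.comp_apply, hφ1, LinearMap.comp_apply, res_dd, map_zero])
  obtain ⟨φ3, hφ3⟩ := lift_lin (ksmul q) (crossProduct q) (fun v hv => hq.e2 v hv)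
    (φ2 ∘ₗ (P.complex.d 3 2).hom) (by
      intro p
      rw [LinearMap.comp_apply, hφ2, LinearMap.comp_apply, res_dd, map_zero])
  obtain ⟨t', h, P', g, hg, β, hβ⟩ := localCoh_class J t (ModuleCat.of R R) P (ModuleCat.ofHom φ3) (by
    ext p
    apply hq.e3
    have := hφ3 ((P.complex.d 4 3).hom p)
    rw [LinearMap.comp_apply, res_dd, map_zero] at this
    exact this) hsub
  refine ⟨t', fun n hn M hM => ?_⟩
  have hgc : ∀ (i j : ℕ) (p : P'.complex.X i),
      (g.f j).hom ((P'.complex.d i j).hom p) = (P.complex.d i j).hom ((g.f i).hom p) := by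
    intro i j p
    exact (congrArg (fun z => z.hom p) (g.comm i j)).symm
  let F : Fin 3 → R := fun i => f i ^ n
  let π' : P'.complex.X 0 →ₗ[R] R ⧸ J ^ t' := (P'.π.f 0).hom
  have hg0 : ∀ p, π ((g.f 0).hom p) = Submodule.mapQ (J ^ t') (J ^ t) LinearMap.id h (π' p) :=
    fun p => congrArg (fun z => z.hom p) hg
  obtain ⟨p0, hp0⟩ := res_surj P' (Submodule.Quotient.mk (1 : R) : R ⧸ J ^ t')
  let κ0 : R →ₗ[R] P'.complex.X 0 := LinearMap.toSpanSingleton R _ p0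
  have hκ0 : ∀ r, π' (κ0 r) = Submodule.Quotient.mk r := by
    intro r
    have : π' p0 = Submodule.Quotient.mk (1 : R) := hp0
    simp only [κ0, LinearMap.toSpanSingleton_apply, map_smul, this]
    rw [← Submodule.Quotient.mk_smul, smul_eq_mul, mul_one]
  have hF : ∀ v, kdot F v ∈ J ^ t' := by
    intro v
    simp only [kdot, LinearMap.coe_mk, AddHom.coe_mk, dotProduct]
    exact Ideal.sum_mem _ fun i _ => Ideal.mul_mem_right _ _
      (Ideal.pow_le_pow_right hn (Ideal.pow_mem_pow (hf i) n))
  obtain ⟨κ1, hκ1⟩ := lift_lin (P'.complex.d 1 0).hom π' (fun y hy => res_exact_zero P' y hy)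
    (κ0 ∘ₗ kdot F) (by
      intro v
      rw [LinearMap.comp_apply, hκ0]
      exact (Submodule.Quotient.mk_eq_zero _).2 (hF v))
  obtain ⟨κ2, hκ2⟩ := lift_lin (P'.complex.d 2 1).hom (P'.complex.d 1 0).hom (res_exact P' 0)
    (κ1 ∘ₗ crossProduct F) (by
      intro v
      rw [LinearMap.comp_apply, hκ1, LinearMap.comp_apply, kdot_cross, map_zero])
  obtain ⟨κ3, hκ3⟩ := lift_lin (P'.complex.d 3 2).hom (P'.complex.d 2 1).hom (res_exact P' 1)
    (κ2 ∘ₗ ksmul F) (by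
      intro v
      rw [LinearMap.comp_apply, hκ2, LinearMap.comp_apply, cross_ksmul, map_zero])
  have hc := compare q F hq M hM (φ0 ∘ₗ (g.f 0).hom ∘ₗ κ0) (φ3 ∘ₗ (g.f 3).hom ∘ₗ κ3)
    (φ1 ∘ₗ (g.f 1).hom ∘ₗ κ1) (φ2 ∘ₗ (g.f 2).hom ∘ₗ κ2)
    (by
      have e : mk (φ0 ((g.f 0).hom (κ0 1))) = mk 1 := by
        rw [hφ0, hg0, hκ0]; rfl
      rw [← sub_eq_zero, ← map_sub] at e
      exact (Submodule.Quotient.mk_eq_zero _).1 e)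
    (by
      intro v
      simp only [LinearMap.comp_apply] at hφ1 hκ1 ⊢
      rw [hφ1, ← hgc, hκ1])
    (by
      intro v
      simp only [LinearMap.comp_apply] at hφ2 hκ2 ⊢
      rw [hφ2, ← hgc, hκ2])
    (by
      intro v
      simp only [LinearMap.comp_apply] at hφ3 hκ3 ⊢
      rw [hφ3, ← hgc, hκ3])
  have e3 : φ3 ((g.f 3).hom (κ3 1)) = (β.hom ∘ₗ κ2) F := by
    have e := congrArg (fun z => z.hom (κ3 1)) hβ
    have e' : β.hom ((P'.complex.d 3 2).hom (κ3 1)) = φ3 ((g.f 3).hom (κ3 1)) := e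
    rw [← e', hκ3]
    simp
  have e4 := apply_mem_span F (β.hom ∘ₗ κ2)
  rw [← e3] at e4
  have := Ideal.sub_mem _ e4 hc
  simpa using this

end

section
open MvPolynomial
open MvPolynomial

theorem fischer_hom {K : Type*} [Field K] {σ : Type*} :
    ∃ θ : MvPolynomial σ K →ₐ[K] Module.End K (MvPolynomial σ K),
      ∀ i p, θ (X i) p = pderiv i p := by
  classical
  let s : Set (Module.End K (MvPolynomial σ K)) :=
    Set.range fun i => (pderiv i : Derivation K (MvPolynomial σ K) (MvPolynomial σ K)).toLinearMap
  have hcomm : ∀ a ∈ s, ∀ b ∈ s, a * b = b * a := by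
    rintro _ ⟨i, rfl⟩ _ ⟨j, rfl⟩
    refine LinearMap.ext fun p => ?_
    change pderiv i (pderiv j p) = pderiv j (pderiv i p)
    ext m
    simp only [coeff_pderiv]
    by_cases h : i = j
    · subst h; rfl
    · have h' : j ≠ i := fun e => h e.symm
      have e1 : m + Finsupp.single i 1 + Finsupp.single j 1
        = m + Finsupp.single j 1 + Finsupp.single i 1 := add_right_comm _ _ _
      rw [e1]
      simp [h, h']
      ring
  letI : CommRing (Algebra.adjoin K s) := Algebra.adjoinCommRingOfComm K hcomm
  let θ0 : MvPolynomial σ K →ₐ[K] Algebra.adjoin K s :=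
    aeval fun i => ⟨_, Algebra.subset_adjoin ⟨i, rfl⟩⟩
  refine ⟨(Algebra.adjoin K s).val.comp θ0, fun i p => ?_⟩
  simp [θ0]

section
variable {K : Type*} [Field K]

noncomputable def dl (K : Type*) [Field K] : Fin 3 → MvPolynomial (Fin 10) K :=
  ![X 1 * X 5 - X 2 * X 4, X 0 * X 5 - X 2 * X 3, X 0 * X 4 - X 1 * X 3]

theorem dl_zero : dl K 0 = X 1 * X 5 - X 2 * X 4 := rfl
theorem dl_one : dl K 1 = X 0 * X 5 - X 2 * X 3 := rfl
theorem dl_two : dl K 2 = X 0 * X 4 - X 1 * X 3 := rfl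

theorem chain_rule (i : Fin 10) (F : MvPolynomial (Fin 3) K) :
    pderiv i (bind₁ (dl K) F) = ∑ j, bind₁ (dl K) (pderiv j F) * pderiv i (dl K j) := by
  classical
  induction F using MvPolynomial.induction_on with
  | C a => simp
  | add p q hp hq => simp only [map_add, hp, hq, add_mul, Finset.sum_add_distrib]
  | mul_X p n hp =>
    simp only [map_mul, bind₁_X_right, Derivation.leibniz, smul_eq_mul, hp, map_add, add_mul,
      Finset.sum_add_distrib, Finset.mul_sum, pderiv_X, Pi.single_apply]
    simp [mul_assoc]

/-- the operator `(E + 2) ∂_j` -/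
noncomputable def TT (j : Fin 3) (F : MvPolynomial (Fin 3) K) : MvPolynomial (Fin 3) K :=
  2 * pderiv j F + ∑ i, X i * pderiv i (pderiv j F)

theorem pderiv_swap {σ : Type*} (i j : σ) (p : MvPolynomial σ K) :
    pderiv i (pderiv j p) = pderiv j (pderiv i p) := by
  classical
  obtain ⟨θ, hθ⟩ := fischer_hom (K := K) (σ := σ)
  have h := congrArg (fun x => θ x p) (mul_comm (X i) (X j))
  simpa only [map_mul, Module.End.mul_apply, hθ] using h

theorem theta_dl (θ : MvPolynomial (Fin 10) K →ₐ[K] Module.End K (MvPolynomial (Fin 10) K))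
    (hθ : ∀ i p, θ (X i) p = pderiv i p) (j : Fin 3) (F : MvPolynomial (Fin 3) K) :
    θ (dl K j) (bind₁ (dl K) F) = bind₁ (dl K) (TT j F) := by
  have h01 := pderiv_swap (0 : Fin 3) 1 F
  have h02 := pderiv_swap (0 : Fin 3) 2 F
  have h12 := pderiv_swap (1 : Fin 3) 2 F
  have key : ∀ a b c d : Fin 10, θ (X a * X b - X c * X d) (bind₁ (dl K) F) =
    pderiv a (pderiv b (bind₁ (dl K) F)) - pderiv c (pderiv d (bind₁ (dl K) F)) := by
    intro a b c d
    simp only [map_sub, map_mul, LinearMap.sub_apply, Module.End.mul_apply, hθ]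
  have h2 : bind₁ (dl K) 2 = 2 := map_ofNat _ 2
  have hj : j = 0 ∨ j = 1 ∨ j = 2 := by fin_cases j <;> simp
  rcases hj with rfl | rfl | rfl
  · rw [show θ (dl K 0) = θ (X 1 * X 5 - X 2 * X 4) from rfl, key]
    simp only [TT, chain_rule, Fin.sum_univ_three, Derivation.leibniz, map_add, map_mul, h2,
      bind₁_X_right, smul_eq_mul, h01, h02, h12]
    simp only [dl_zero, dl_one, dl_two, map_sub, Derivation.leibniz, smul_eq_mul, pderiv_X]
    simp [Pi.single_apply]
    ring
  · rw [show θ (dl K 1) = θ (X 0 * X 5 - X 2 * X 3) from rfl, key]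
    simp only [TT, chain_rule, Fin.sum_univ_three, Derivation.leibniz, map_add, map_mul, h2,
      bind₁_X_right, smul_eq_mul, h01, h02, h12]
    simp only [dl_zero, dl_one, dl_two, map_sub, Derivation.leibniz, smul_eq_mul, pderiv_X]
    simp [Pi.single_apply]
    ring
  · rw [show θ (dl K 2) = θ (X 0 * X 4 - X 1 * X 3) from rfl, key]
    simp only [TT, chain_rule, Fin.sum_univ_three, Derivation.leibniz, map_add, map_mul, h2,
      bind₁_X_right, smul_eq_mul, h01, h02, h12]
    simp only [dl_zero, dl_one, dl_two, map_sub, Derivation.leibniz, smul_eq_mul, pderiv_X]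
    simp [Pi.single_apply]
    ring

theorem TT_monomial_zero (j : Fin 3) (m : Fin 3 →₀ ℕ) (r : K) (h : m j = 0) :
    TT j (monomial m r) = 0 := by
  simp [TT, pderiv_monomial, h]

theorem TT_monomial (j : Fin 3) (m : Fin 3 →₀ ℕ) (r : K) :
    TT j (monomial m r) = monomial (m - Finsupp.single j 1)
      (r * m j * ((2 + ∑ i, (m - Finsupp.single j 1 : Fin 3 →₀ ℕ) i : ℕ) : K)) := by
  have : ∀ i : Fin 3, X i * pderiv i (pderiv j (monomial m r)) = 
     (m - Finsupp.single j 1 : Fin 3 →₀ ℕ) i • pderiv j (monomial m r) := by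
    intro i
    rw [pderiv_monomial (i := j), X_mul_pderiv_monomial]
  simp only [TT, this, ← Finset.sum_smul]
  rw [← Nat.cast_ofNat (n := 2), ← nsmul_eq_mul, ← add_smul, pderiv_monomial, smul_monomial]
  congr 1
  rw [nsmul_eq_mul, mul_comm]

theorem TT_iter [CharZero K] (j : Fin 3) (k : ℕ) : ∀ (m : Fin 3 →₀ ℕ) (r : K), r ≠ 0 → k ≤ m j →
    ∃ c : K, c ≠ 0 ∧ (TT j)^[k] (monomial m r) = monomial (m - Finsupp.single j k) c := by
  induction k with
  | zero => intro m r hr _; exact ⟨r, hr, by simp⟩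
  | succ k ih =>
    intro m r hr hk
    obtain ⟨c, hc, e⟩ := ih m r hr (by omega)
    have hm : m - Finsupp.single j k - Finsupp.single j 1 = m - Finsupp.single j (k + 1) := by
      ext i
      simp [Finsupp.single_apply]
      split_ifs <;> omega
    refine ⟨c * ((m - Finsupp.single j k : Fin 3 →₀ ℕ) j : K) *
      ((2 + ∑ i, (m - Finsupp.single j k - Finsupp.single j 1 : Fin 3 →₀ ℕ) i : ℕ) : K), ?_, ?_⟩
    · refine mul_ne_zero (mul_ne_zero hc ?_) ?_
      · rw [Nat.cast_ne_zero]
        simp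
        omega
      · rw [Nat.cast_ne_zero]; omega
    · rw [Function.iterate_succ_apply', e, TT_monomial, hm]

theorem TT_iter_zero [CharZero K] (j : Fin 3) (m : Fin 3 →₀ ℕ) (r : K) :
    (TT j)^[m j + 1] (monomial m r) = 0 := by
  by_cases hr : r = 0
  · subst hr
    have h0 : TT j (0 : MvPolynomial (Fin 3) K) = 0 := by simp [TT]
    rw [map_zero, Function.iterate_fixed h0]
  obtain ⟨c, hc, e⟩ := TT_iter j (m j) m r hr le_rfl
  rw [Function.iterate_succ_apply', e, TT_monomial_zero]
  simp

theorem theta_pow (θ : MvPolynomial (Fin 10) K →ₐ[K] Module.End K (MvPolynomial (Fin 10) K))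
    (hθ : ∀ i p, θ (X i) p = pderiv i p) (j : Fin 3) (k : ℕ) (F : MvPolynomial (Fin 3) K) :
    θ (dl K j ^ k) (bind₁ (dl K) F) = bind₁ (dl K) ((TT j)^[k] F) := by
  induction k with
  | zero => simp
  | succ k ih => rw [pow_succ', map_mul, Module.End.mul_apply, ih, theta_dl θ hθ,
      Function.iterate_succ_apply']

theorem fischer_notMem [CharZero K] (m : ℕ) :
    (dl K 0 * dl K 1 * dl K 2) ^ m ∉ Ideal.span (Set.range fun i => dl K i ^ (m + 1)) := by
  obtain ⟨θ, hθ⟩ := fischer_hom (K := K) (σ := Fin 10)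
  let e : Fin 3 →₀ ℕ := Finsupp.equivFunOnFinite.symm fun _ => m
  have he : ∀ i, e i = m := fun i => rfl
  let g : MvPolynomial (Fin 10) K := bind₁ (dl K) (monomial e 1)
  have h0 : ∀ p ∈ Ideal.span (Set.range fun i => dl K i ^ (m + 1)), θ p g = 0 := by
    intro p hp
    induction hp using Submodule.span_induction with
    | mem x hx =>
      obtain ⟨i, rfl⟩ := hx
      have := TT_iter_zero i e (1 : K)
      rw [he] at this
      simp only [g]
      rw [theta_pow θ hθ, this, map_zero]
    | zero => simp
    | add x y _ _ hx hy => rw [map_add, LinearMap.add_apply, hx, hy, add_zero]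
    | smul a x _ hx => rw [smul_eq_mul, map_mul, Module.End.mul_apply, hx, map_zero]
  intro hmem
  have h1 := h0 _ hmem
  obtain ⟨c2, hc2, e2⟩ := TT_iter 2 m e (1 : K) one_ne_zero (he 2).ge
  obtain ⟨c1, hc1, e1⟩ := TT_iter 1 m (e - Finsupp.single 2 m) c2 hc2 (by simp [he])
  obtain ⟨c0, hc0, e0⟩ := TT_iter 0 m (e - Finsupp.single 2 m - Finsupp.single 1 m) c1 hc1
    (by simp [he])
  rw [mul_pow, mul_pow, map_mul, map_mul, Module.End.mul_apply, Module.End.mul_apply] at h1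
  simp only [g] at h1
  rw [theta_pow θ hθ, e2, theta_pow θ hθ, e1, theta_pow θ hθ, e0] at h1
  have hz : e - Finsupp.single 2 m - Finsupp.single 1 m - Finsupp.single 0 m = 0 := by
    ext i
    fin_cases i <;> simp [he]
  rw [hz] at h1
  have h2 : bind₁ (dl K) (C c0) = 0 := h1
  rw [bind₁_C_right, C_eq_zero] at h2
  exact hc0 h2
end

section
variable {K : Type*} [Field K]

theorem kexact_of_reg {R : Type*} [CommRing R] [IsDomain R] (q : Fin 3 → R) (h0 : q 0 ≠ 0)
    (h1 : ∀ b, q 0 ∣ b * q 1 → q 0 ∣ b)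
    (h2 : ∀ a, (∃ u v, a * q 2 = u * q 0 + v * q 1) → ∃ u v, a = u * q 0 + v * q 1) :
    KExact q := by
  constructor
  · intro a ha
    rw [dotProduct, Fin.sum_univ_three] at ha
    obtain ⟨u, v, huv⟩ := h2 (a 2) ⟨-a 0, -a 1, by linear_combination ha⟩
    obtain ⟨w, hw⟩ := h1 (a 1 + v * q 2) ⟨-(a 0 + u * q 2), by
      linear_combination ha - q 2 * huv⟩
    have hw' : a 0 + u * q 2 = - w * q 1 := by
      apply mul_left_cancel₀ h0
      linear_combination ha - q 2 * huv - q 1 * hw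
    refine ⟨![-v, u, -w], ?_⟩
    rw [cross_apply]
    ext i
    fin_cases i
    · simp; linear_combination -hw'
    · simp; linear_combination -hw
    · simp; linear_combination -huv
  · intro b hb
    rw [cross_apply] at hb
    have e2 := congrFun hb 2
    have e1 := congrFun hb 1
    simp at e1 e2
    obtain ⟨r, hr⟩ := h1 (b 0) ⟨b 1, by linear_combination -e2⟩
    refine ⟨r, ?_⟩
    ext i
    fin_cases i
    · simp [hr]; ring
    · simp
      apply mul_left_cancel₀ h0
      linear_combination -e2 - q 1 * hr
    · simp
      apply mul_left_cancel₀ h0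
      linear_combination e1 - q 2 * hr
  · intro r hr
    have := congrFun hr 0
    simp at this
    exact this.resolve_right h0

noncomputable def qq (K : Type*) [Field K] : Fin 3 → MvPolynomial (Fin 10) K :=
  ![X 0 - X 4, dl K 2, X 5 * dl K 0 - X 2 * dl K 1]

theorem qq_zero : qq K 0 = X 0 - X 4 := rfl
theorem qq_one : qq K 1 = dl K 2 := rfl
theorem qq_two : qq K 2 = X 5 * dl K 0 - X 2 * dl K 1 := rfl

theorem qq_kexact : KExact (qq K) := by
  classical
  let σ : MvPolynomial (Fin 10) K →ₐ[K] MvPolynomial (Fin 10) K :=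
    aeval fun i => if i = 4 then X 0 else X i
  have hσX : ∀ i, σ (X i) = if i = 4 then X 0 else X i := fun i => by simp only [σ, aeval_X]
  have hσ : ∀ p, qq K 0 ∣ p - σ p := by
    intro p
    induction p using MvPolynomial.induction_on with
    | C a => simp [σ]
    | add p q hp hq =>
      rw [map_add, add_sub_add_comm]; exact dvd_add hp hq
    | mul_X p n hp =>
      have : p * X n - σ (p * X n) = (p - σ p) * X n + σ p * (X n - σ (X n)) := by
        rw [map_mul]; ring
      rw [this]
      refine dvd_add (hp.mul_right _) (Dvd.dvd.mul_left ?_ _)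
      rw [hσX]
      split_ifs with h
      · subst h; exact ⟨-1, by rw [qq_zero]; ring⟩
      · simp
  have hσ0 : σ (qq K 0) = 0 := by
    rw [qq_zero, map_sub, hσX, hσX]; simp
  have hdvd : ∀ b, σ b = 0 → qq K 0 ∣ b := fun b hb => by
    have := hσ b
    rwa [hb, sub_zero] at this
  have hσ1 : σ (qq K 1) = X 0 ^ 2 - X 1 * X 3 := by
    simp [qq_one, dl_two, hσX]; ring
  have hirr : Irreducible (σ (qq K 1)) := by
    have hx : (X 3 : MvPolynomial (Fin 10) K) ≠ 0 := X_ne_zero _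
    have := MvPolynomial.irreducible_mul_X_add (-X 3 : MvPolynomial (Fin 10) K) (X 0 ^ 2) 1
      (neg_ne_zero.2 hx) (by simp [vars_X]) (by
        intro h
        have := vars_pow (X 0 : MvPolynomial (Fin 10) K) 2 h
        simp [vars_X] at this) (by
        rw [IsRelPrime.neg_left_iff]
        refine IsRelPrime.pow_right ?_
        refine (Irreducible.isRelPrime_iff_not_dvd (X_prime.irreducible)).2 ?_
        rw [X_dvd_X]; simp)
    rw [hσ1]
    convert this using 1
    ring
  have hpr : Prime (σ (qq K 1)) := hirr.prime
  have hnd : ¬ σ (qq K 1) ∣ σ (qq K 2) := by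
    rintro ⟨c, hc⟩
    have h := congrArg (eval (fun i : Fin 10 => if i = 2 ∨ i = 3 then (1 : K) else 0)) hc
    rw [hσ1] at h
    simp [qq_two, dl_zero, dl_one, hσX] at h
  refine kexact_of_reg _ ?_ ?_ ?_
  · rw [qq_zero, sub_ne_zero]
    intro h
    have := X_injective h
    simp at this
  · rintro b ⟨c, hc⟩
    apply hdvd
    have h := congrArg σ hc
    rw [map_mul, map_mul, hσ0, zero_mul] at h
    exact (mul_eq_zero.1 h).resolve_right hpr.ne_zero
  · rintro a ⟨u, v, h⟩
    have h := congrArg σ h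
    rw [map_mul, map_add, map_mul, map_mul, hσ0, mul_zero, zero_add] at h
    have hd : σ (qq K 1) ∣ σ a :=
      (hpr.dvd_or_dvd (show σ (qq K 1) ∣ σ a * σ (qq K 2) from ⟨σ v, by rw [h, mul_comm]⟩)).resolve_right hnd
    obtain ⟨w, hw⟩ := hd
    obtain ⟨x, hx⟩ := hσ a
    obtain ⟨y, hy⟩ := hσ (qq K 1)
    exact ⟨x - y * w, w, by linear_combination hx + hw - w * hy⟩

theorem dl_mem_radical (i : Fin 3) : dl K i ∈ (Ideal.span (Set.range (qq K))).radical := by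
  have m : ∀ j, qq K j ∈ Ideal.span (Set.range (qq K)) := fun j => Ideal.subset_span ⟨j, rfl⟩
  have hi : i = 0 ∨ i = 1 ∨ i = 2 := by fin_cases i <;> simp
  rcases hi with rfl | rfl | rfl
  · refine ⟨2, ?_⟩
    have : dl K 0 ^ 2 = X 2 * dl K 0 * qq K 0 + X 2 ^ 2 * qq K 1 + X 1 * qq K 2 := by
      simp only [qq_zero, qq_one, qq_two, dl_zero, dl_one, dl_two]; ring
    rw [this]
    exact add_mem (add_mem (Ideal.mul_mem_left _ _ (m 0)) (Ideal.mul_mem_left _ _ (m 1)))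
      (Ideal.mul_mem_left _ _ (m 2))
  · refine ⟨2, ?_⟩
    have : dl K 1 ^ 2 = X 5 * dl K 1 * qq K 0 + X 5 ^ 2 * qq K 1 + X 3 * qq K 2 := by
      simp only [qq_zero, qq_one, qq_two, dl_zero, dl_one, dl_two]; ring
    rw [this]
    exact add_mem (add_mem (Ideal.mul_mem_left _ _ (m 0)) (Ideal.mul_mem_left _ _ (m 1)))
      (Ideal.mul_mem_left _ _ (m 2))
  · exact Ideal.le_radical (m 1)

theorem minors_le (J : Ideal (MvPolynomial (Fin 10) K)) (hJ : ∀ i, dl K i ∈ J) :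
    minorsIdeal 3 (exampleMatrix12 K) ≤ J := by
  refine Ideal.span_le.2 ?_
  rintro _ ⟨r, c, hr, -, rfl⟩
  -- the `2 × 2` minors of the first two rows lie in `J`
  have h2 : ∀ a b : Fin 4, exampleMatrix12 K 0 a * exampleMatrix12 K 1 b -
      exampleMatrix12 K 0 b * exampleMatrix12 K 1 a ∈ J := by
    have h0 := hJ 0
    have h1 := hJ 1
    have h2 := hJ 2
    have h0' := J.neg_mem h0
    have h1' := J.neg_mem h1
    have h2' := J.neg_mem h2
    rw [dl_zero] at h0 h0'
    rw [dl_one] at h1 h1'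
    rw [dl_two] at h2 h2'
    rw [neg_sub] at h0' h1' h2'
    intro a b
    fin_cases a <;> fin_cases b <;> simp [exampleMatrix12, h0, h1, h2, h0', h1', h2']
    all_goals first
      | simpa [mul_comm] using h0
      | simpa [mul_comm] using h1
      | simpa [mul_comm] using h2 | simpa [mul_comm] using h0' | simpa [mul_comm] using h1'
      | simpa [mul_comm] using h2'
  have hid : ((exampleMatrix12 K).submatrix id c).det ∈ J := by
    have : ((exampleMatrix12 K).submatrix id c).det =
        exampleMatrix12 K 2 (c 0) * (exampleMatrix12 K 0 (c 1) * exampleMatrix12 K 1 (c 2) -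
          exampleMatrix12 K 0 (c 2) * exampleMatrix12 K 1 (c 1)) -
        exampleMatrix12 K 2 (c 1) * (exampleMatrix12 K 0 (c 0) * exampleMatrix12 K 1 (c 2) -
          exampleMatrix12 K 0 (c 2) * exampleMatrix12 K 1 (c 0)) +
        exampleMatrix12 K 2 (c 2) * (exampleMatrix12 K 0 (c 0) * exampleMatrix12 K 1 (c 1) -
          exampleMatrix12 K 0 (c 1) * exampleMatrix12 K 1 (c 0)) := by
      rw [Matrix.det_fin_three]
      simp only [Matrix.submatrix_apply, id]
      ring
    rw [this]
    exact add_mem (sub_mem (Ideal.mul_mem_left _ _ (h2 _ _)) (Ideal.mul_mem_left _ _ (h2 _ _)))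
      (Ideal.mul_mem_left _ _ (h2 _ _))
  let e : Equiv.Perm (Fin 3) := Equiv.ofBijective r (Finite.injective_iff_bijective.1 hr)
  have hdet := Matrix.det_permute e ((exampleMatrix12 K).submatrix id c)
  have he : (exampleMatrix12 K).submatrix r c =
    ((exampleMatrix12 K).submatrix id c).submatrix e id := rfl
  rw [SetLike.mem_coe, he, hdet]
  exact Ideal.mul_mem_left _ _ hid

theorem gens_mem (i : Fin 3) : X 6 * dl K i ∈ minorsIdeal 3 (exampleMatrix12 K) := by
  have key : ∀ c : Fin 3 → Fin 4, Function.Injective c →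
      ((exampleMatrix12 K).submatrix id c).det ∈ minorsIdeal 3 (exampleMatrix12 K) :=
    fun c hc => Ideal.subset_span ⟨id, c, Function.injective_id, hc, rfl⟩
  have hi : i = 0 ∨ i = 1 ∨ i = 2 := by fin_cases i <;> simp
  rcases hi with rfl | rfl | rfl
  · convert key ![0, 2, 3] (by decide) using 1
    rw [Matrix.det_fin_three, dl_zero]
    simp [exampleMatrix12]
    ring
  · convert key ![0, 1, 3] (by decide) using 1
    rw [Matrix.det_fin_three, dl_one]
    simp [exampleMatrix12]
    ring
  · convert key ![0, 1, 2] (by decide) using 1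
    rw [Matrix.det_fin_three, dl_two]
    simp [exampleMatrix12]
    ring

theorem no_det [CharZero K] (k : ℕ) (h : ∀ M : Matrix (Fin 3) (Fin 3) (MvPolynomial (Fin 10) K),
    M.mulVec (qq K) = (fun i => (X 6 * dl K i) ^ (k + 2)) →
      M.det ∈ Ideal.span (Set.range (fun i => (X 6 * dl K i) ^ (k + 2)))) : False := by
  classical
  let Z : MvPolynomial (Fin 10) K := X 6 ^ (k + 2)
  let M : Matrix (Fin 3) (Fin 3) (MvPolynomial (Fin 10) K) :=
    !![Z * dl K 0 ^ k * (X 2 * dl K 0), Z * dl K 0 ^ k * X 2 ^ 2, Z * dl K 0 ^ k * X 1;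
       Z * dl K 1 ^ k * (X 5 * dl K 1), Z * dl K 1 ^ k * X 5 ^ 2, Z * dl K 1 ^ k * X 3;
       0, Z * dl K 2 ^ (k + 1), 0]
  have e0 : dl K 0 ^ 2 = X 2 * dl K 0 * qq K 0 + X 2 ^ 2 * qq K 1 + X 1 * qq K 2 := by
    simp only [qq_zero, qq_one, qq_two, dl_zero, dl_one, dl_two]; ring
  have e1 : dl K 1 ^ 2 = X 5 * dl K 1 * qq K 0 + X 5 ^ 2 * qq K 1 + X 3 * qq K 2 := by
    simp only [qq_zero, qq_one, qq_two, dl_zero, dl_one, dl_two]; ring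
  have hM := h M (by
    ext1 i
    have hi : i = 0 ∨ i = 1 ∨ i = 2 := by fin_cases i <;> simp
    rcases hi with rfl | rfl | rfl
    · simp only [Matrix.mulVec, dotProduct, Fin.sum_univ_three, M, mul_pow, pow_add _ k 2, e0]
      simp [Z]
      ring
    · simp only [Matrix.mulVec, dotProduct, Fin.sum_univ_three, M, mul_pow, pow_add _ k 2, e1]
      simp [Z]
      ring
    · simp only [Matrix.mulVec, dotProduct, Fin.sum_univ_three, M, mul_pow, qq_one]
      simp [Z]
      ring)
  -- specialize `X 6` to `1`
  let φ : MvPolynomial (Fin 10) K →ₐ[K] MvPolynomial (Fin 10) K :=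
    aeval fun i => if i = 6 then 1 else X i
  have hφX : ∀ i, φ (X i) = if i = 6 then 1 else X i := fun i => by simp only [φ, aeval_X]
  have hφ : ∀ i, φ (dl K i) = dl K i := by
    intro i
    have hi : i = 0 ∨ i = 1 ∨ i = 2 := by fin_cases i <;> simp
    rcases hi with rfl | rfl | rfl
    · simp [dl_zero, hφX]
    · simp [dl_one, hφX]
    · simp [dl_two, hφX]
  have hZ : φ Z = 1 := by simp [Z, hφX]
  have hmem := Ideal.mem_map_of_mem φ hM
  have hle : Ideal.map φ (Ideal.span (Set.range (fun i => (X 6 * dl K i) ^ (k + 2)))) ≤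
      Ideal.span (Set.range fun i => dl K i ^ (k + 1 + 1)) := by
    rw [Ideal.map_span, Ideal.span_le]
    rintro _ ⟨_, ⟨i, rfl⟩, rfl⟩
    have : φ ((X 6 * dl K i) ^ (k + 2)) = dl K i ^ (k + 1 + 1) := by
      rw [map_pow, map_mul, hφ, hφX]; simp
    rw [SetLike.mem_coe, this]
    exact Ideal.subset_span ⟨i, rfl⟩
  replace hmem := hle hmem
  have hdet : (dl K 0 * dl K 1 * dl K 2) ^ (k + 1) =
      φ M.det + (-X 5 * X 2 * dl K 0 ^ k * dl K 1 ^ k) * dl K 2 ^ (k + 1 + 1) := by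
    rw [Matrix.det_fin_three]
    simp [M, hφ, hφX, hZ]
    have p : X 0 * dl K 0 - X 1 * dl K 1 + X 2 * dl K 2 = 0 := by
      simp only [dl_zero, dl_one, dl_two]; ring
    have q : X 2 * X 3 = X 0 * X 5 - dl K 1 := by rw [dl_one]; ring
    linear_combination (dl K 0 ^ k * dl K 1 ^ k * dl K 2 ^ (k + 1)) * (dl K 0 * q + X 5 * p)
  refine fischer_notMem (K := K) (k + 1) ?_
  rw [hdet]
  exact add_mem hmem (Ideal.mul_mem_left _ _ (Ideal.subset_span ⟨2, rfl⟩))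

end

end
end Stmt12Aux

/-- For the above matrix over a field of characteristic zero, with `I = I_3(X)` the
ideal of maximal minors, the local cohomology module `H^3_I(R)` is nonzero. -/
theorem stmt12 {K : Type*} [Field K] [CharZero K] :
    Nontrivial ((localCohomology (minorsIdeal 3 (exampleMatrix12 K)) 3).obj
      (ModuleCat.of (MvPolynomial (Fin 10) K) (MvPolynomial (Fin 10) K))) := by
  by_contra hcon
  have hsub := not_nontrivial_iff_subsingleton.1 hcon
  obtain ⟨t, ht⟩ := Ideal.exists_pow_le_of_le_radical_of_fg
    (Stmt12Aux.minors_le (K := K) _ Stmt12Aux.dl_mem_radical)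
    (IsNoetherian.noetherian _)
  obtain ⟨t', ht'⟩ := Stmt12Aux.main_alg _ (Stmt12Aux.qq K)
    (fun i => MvPolynomial.X 6 * Stmt12Aux.dl K i) Stmt12Aux.qq_kexact t ht
    Stmt12Aux.gens_mem hsub
  exact Stmt12Aux.no_det t' (ht' (t' + 2) (by omega))
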